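/- (Proposition 1) Let n, m ≥ 1 and v₁, v₂ > 0. Let π : ℝ^{n×m} → [0,∞] be superharmonic on ℝ^{nm}, with 0 < m_π(Z; v) < ∞ for every Z ∈ ℝ^{n×m} and every v > 0, and assume the Kullback–Leibler risks below are finite. Then the Bayesian predictive density based on π improves on the one based on the uniform prior: for every M ∈ ℝ^{n×m}, R_KL(M, p̂_π) ≤ R_KL(M, p̂_I). -/

import Mathlib

open MeasureTheory Metric ENNReal

/-- A function `f : ℝ^d → [0,∞]` (with `d = card ι`) is superharmonic if it is lower
semicontinuous, not identically `+∞`, and its mean over every sphere (with respect to the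
normalized `(d-1)`-dimensional Hausdorff surface measure) is at most its value at the
center. -/
def SuperharmonicFn (ι : Type) [Fintype ι] (f : EuclideanSpace ℝ ι → ℝ≥0∞) : Prop :=
  LowerSemicontinuous f ∧ (∃ x, f x ≠ ⊤) ∧
    ∀ (x : EuclideanSpace ℝ ι) (δ : ℝ), 0 < δ →
      ∫⁻ z in sphere x δ, f z
          ∂((μH[(Fintype.card ι : ℝ) - 1] (sphere x δ))⁻¹ •
            μH[(Fintype.card ι : ℝ) - 1]) ≤ f x

/-- The density of the matrix-variate normal `N_{n,m}(M, v I_n, I_m)` at `X`, where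
`ℝ^{n×m}` is identified with `ℝ^{nm}` and `‖·‖` is the (Frobenius) Euclidean norm. -/
noncomputable def pdens (n m : ℕ) (v : ℝ) (X M : EuclideanSpace ℝ (Fin n × Fin m)) : ℝ :=
  (2 * Real.pi * v) ^ (-((n : ℝ) * m) / 2) * Real.exp (-‖X - M‖ ^ 2 / (2 * v))

/-- The marginal `m_π(Z; v) = ∫ p_v(Z|M) π(M) dM` of a prior `π`. -/
noncomputable def marg (n m : ℕ) (π : EuclideanSpace ℝ (Fin n × Fin m) → ℝ≥0∞) (v : ℝ)
    (Z : EuclideanSpace ℝ (Fin n × Fin m)) : ℝ≥0∞ :=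
  ∫⁻ M, ENNReal.ofReal (pdens n m v Z M) * π M

/-- The Bayesian predictive density based on the prior `π`. -/
noncomputable def predPi (n m : ℕ) (π : EuclideanSpace ℝ (Fin n × Fin m) → ℝ≥0∞)
    (v₁ v₂ : ℝ) (Y Yt : EuclideanSpace ℝ (Fin n × Fin m)) : ℝ :=
  (∫⁻ M, ENNReal.ofReal (pdens n m v₂ Yt M * pdens n m v₁ Y M) * π M).toReal /
    (marg n m π v₁ Y).toReal

/-- The predictive density based on the uniform prior: `p̂_I(Ỹ|Y) = p_{v₁+v₂}(Ỹ|Y)`. -/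
noncomputable def predI (n m : ℕ) (v₁ v₂ : ℝ)
    (Y Yt : EuclideanSpace ℝ (Fin n × Fin m)) : ℝ :=
  pdens n m (v₁ + v₂) Yt Y

/-- The Kullback–Leibler risk of a predictive density `p̂(·|·)` at the parameter `M`. -/
noncomputable def RKL (n m : ℕ) (v₁ v₂ : ℝ) (M : EuclideanSpace ℝ (Fin n × Fin m))
    (phat : EuclideanSpace ℝ (Fin n × Fin m) → EuclideanSpace ℝ (Fin n × Fin m) → ℝ) : ℝ :=
  ∫ p : EuclideanSpace ℝ (Fin n × Fin m) × EuclideanSpace ℝ (Fin n × Fin m),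
    pdens n m v₁ p.1 M * pdens n m v₂ p.2 M *
      Real.log (pdens n m v₂ p.2 M / phat p.1 p.2)


open Filter Topology Set
open scoped Pointwise

lemma fatou_compare {X : Type*} [PseudoMetricSpace X] [SecondCountableTopology X]
    [MeasurableSpace X] [BorelSpace X]
    (μ ν : Measure X) [IsFiniteMeasure μ] [IsFiniteMeasure ν] (S : Set X)
    (hμ : ∀ᵐ x ∂μ, x ∈ S) (hν : ∀ᵐ x ∂ν, x ∈ S) (a b : ℝ → ℝ≥0∞)
    (ha : ∀ ε > 0, ∀ x ∈ S, μ (ball x ε) = a ε) (hb : ∀ ε > 0, ∀ x ∈ S, ν (ball x ε) = b ε)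
    (hapos : ∀ ε > 0, a ε ≠ 0) (hμ0 : μ univ ≠ 0) (hν0 : ν univ ≠ 0)
    (f : X → ℝ≥0∞) (hf : LowerSemicontinuous f) :
    ∫⁻ x, f x ∂μ ≤ μ univ * ((ν univ)⁻¹ * ∫⁻ x, f x ∂ν) := by
  have hfm : Measurable f := hf.measurable
  have hSne : S.Nonempty := by
    by_contra h
    rw [not_nonempty_iff_eq_empty] at h
    subst h
    simp at hμ
    exact hμ0 (by simp [hμ])
  obtain ⟨s0, hs0⟩ := hSne
  have hmeas : ∀ ε : ℝ, MeasurableSet {p : X × X | dist p.2 p.1 < ε} := fun ε =>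
    measurableSet_lt (by fun_prop) (by fun_prop)
  have hswap : ∀ ε > 0, ∀ g : X → ℝ≥0∞, Measurable g →
      ∫⁻ y, ∫⁻ x in ball y ε, g x ∂ν ∂μ = a ε * ∫⁻ x, g x ∂ν := by
    intro ε hε g hg
    have h1 : ∀ y, ∫⁻ x in ball y ε, g x ∂ν
        = ∫⁻ x, ({p : X × X | dist p.2 p.1 < ε}.indicator (fun p => g p.2)) (y, x) ∂ν := by
      intro y
      rw [← lintegral_indicator measurableSet_ball]
      rfl
    simp_rw [h1]
    rw [lintegral_lintegral_swap]
    · rw [← lintegral_const_mul _ hg]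
      refine lintegral_congr_ae ?_
      filter_upwards [hν] with x hx
      have : ∀ y, ({p : X × X | dist p.2 p.1 < ε}.indicator (fun p => g p.2)) (y, x)
          = (ball x ε).indicator (fun _ => g x) y := by
        intro y
        simp [indicator, dist_comm]
      simp_rw [this]
      rw [lintegral_indicator measurableSet_ball, lintegral_const, Measure.restrict_apply_univ,
        ha ε hε x hx, mul_comm]
    · exact ((hg.comp measurable_snd).indicator (hmeas ε)).aemeasurable
  have hab : ∀ ε > 0, b ε * μ univ = a ε * ν univ := by
    intro ε hε
    have := hswap ε hε (fun _ => 1) measurable_const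
    simp only [lintegral_const, Measure.restrict_apply_univ, one_mul] at this
    rw [← this]
    rw [lintegral_congr_ae (g := fun _ => b ε), lintegral_const]
    filter_upwards [hμ] with x hx using hb ε hε x hx
  have hbtop : ∀ ε > 0, b ε ≠ ⊤ := fun ε hε => by
    rw [← hb ε hε s0 hs0]; exact measure_ne_top _ _
  have hbpos : ∀ ε > 0, b ε ≠ 0 := fun ε hε h => by
    have := hab ε hε
    rw [h, zero_mul] at this
    exact mul_ne_zero (hapos ε hε) hν0 this.symm
  have hratio : ∀ ε > 0, (b ε)⁻¹ * a ε = μ univ * (ν univ)⁻¹ := by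
    intro ε hε
    rw [← div_eq_mul_inv, mul_comm, ← div_eq_mul_inv,
      ENNReal.div_eq_div_iff hν0 (measure_ne_top _ _) (hbpos ε hε) (hbtop ε hε)]
    rw [hab ε hε, mul_comm]
  let e : ℕ → ℝ := fun k => 1 / ((k : ℝ) + 1)
  have he : ∀ k, 0 < e k := fun k => Nat.one_div_pos_of_nat
  have hlim : Tendsto e atTop (𝓝 0) := tendsto_one_div_add_atTop_nhds_zero_nat
  have hmm : ∀ ε, Measurable fun y => ∫⁻ x in ball y ε, f x ∂ν := by
    intro ε
    have h1 : ∀ y, ∫⁻ x in ball y ε, f x ∂ν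
        = ∫⁻ x, ({p : X × X | dist p.2 p.1 < ε}.indicator (fun p => f p.2)) (y, x) ∂ν := by
      intro y
      rw [← lintegral_indicator measurableSet_ball]
      rfl
    simp_rw [h1]
    exact ((hfm.comp measurable_snd).indicator (hmeas ε)).lintegral_prod_right'
  calc ∫⁻ x, f x ∂μ
      ≤ ∫⁻ y, liminf (fun k => (b (e k))⁻¹ * ∫⁻ x in ball y (e k), f x ∂ν) atTop ∂μ := by
        refine lintegral_mono_ae ?_
        filter_upwards [hμ] with y hy
        refine le_of_forall_lt fun c hc => ?_
        obtain ⟨c', hcc', hc'⟩ := exists_between hc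
        refine hcc'.trans_le (le_liminf_of_le (by isBoundedDefault) ?_)
        obtain ⟨r, hr, hball⟩ := Metric.eventually_nhds_iff_ball.1 (hf y c' hc')
        filter_upwards [hlim.eventually (gt_mem_nhds hr)] with k hk
        calc c' = (b (e k))⁻¹ * (c' * b (e k)) := by
              rw [mul_comm c', ← mul_assoc, ENNReal.inv_mul_cancel (hbpos _ (he k)) (hbtop _ (he k)),
                one_mul]
          _ = (b (e k))⁻¹ * ∫⁻ x in ball y (e k), c' ∂ν := by
              rw [lintegral_const, Measure.restrict_apply_univ, hb _ (he k) y hy]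
          _ ≤ _ := by
              gcongr 1
              refine setLIntegral_mono hfm fun x hx => (hball x ?_).le
              exact ball_subset_ball hk.le hx
    _ ≤ liminf (fun k => ∫⁻ y, (b (e k))⁻¹ * ∫⁻ x in ball y (e k), f x ∂ν ∂μ) atTop :=
        lintegral_liminf_le fun k => (hmm _).const_mul _
    _ = liminf (fun k : ℕ => μ univ * ((ν univ)⁻¹ * ∫⁻ x, f x ∂ν)) atTop := by
        congr 1
        ext k
        rw [lintegral_const_mul _ (hmm _), hswap _ (he k) f hfm, ← mul_assoc, hratio _ (he k),
          mul_assoc]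
    _ = _ := by simp

lemma toSphere_ball_eq {ι : Type} [Fintype ι]
    (w w' : sphere (0 : EuclideanSpace ℝ ι) 1) (ε : ℝ) :
    (volume : Measure (EuclideanSpace ℝ ι)).toSphere (ball w ε)
      = (volume : Measure (EuclideanSpace ℝ ι)).toSphere (ball w' ε) := by
  rw [Measure.toSphere_apply' _ measurableSet_ball, Measure.toSphere_apply' _ measurableSet_ball]
  congr 1
  have hw : ‖(w : EuclideanSpace ℝ ι)‖ = ‖(w' : EuclideanSpace ℝ ι)‖ := by simp
  set ρ := Submodule.reflection (ℝ ∙ ((w : EuclideanSpace ℝ ι) - w'))ᗮ with hρ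
  have h1 : ρ (w : EuclideanSpace ℝ ι) = w' := Submodule.reflection_sub hw
  rw [Subtype.image_ball, Subtype.image_ball]
  rw [← ρ.measurePreserving.measure_preimage_equiv (f := ρ.toMeasurableEquiv) (Ioo (0 : ℝ) 1 • (ball (w' : EuclideanSpace ℝ ι) ε ∩ _))]
  congr 1
  ext z
  simp only [mem_preimage, Set.mem_smul]
  have key : ∀ y, dist (ρ y) (w' : EuclideanSpace ℝ ι) = dist y w := by
    intro y; rw [← h1, ρ.dist_map]
  have key2 : ∀ y, ρ (ρ y) = y := fun y => Submodule.reflection_reflection _ _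
  have gen : ∀ u u' : EuclideanSpace ℝ ι, (∀ y, dist (ρ y) u' = dist y u) → ∀ z z', ρ z = z' →
      (∃ r ∈ Ioo (0 : ℝ) 1, ∃ y ∈ ball u ε ∩ {a | a ∈ sphere (0 : EuclideanSpace ℝ ι) 1},
        r • y = z) →
      (∃ r ∈ Ioo (0 : ℝ) 1, ∃ y ∈ ball u' ε ∩ {a | a ∈ sphere (0 : EuclideanSpace ℝ ι) 1},
        r • y = z') := by
    rintro u u' hk z z' rfl ⟨r, hr, y, ⟨hy1, hy2⟩, rfl⟩
    refine ⟨r, hr, ρ y, ⟨?_, ?_⟩, ?_⟩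
    · rw [mem_ball, hk]; exact hy1
    · have : ‖y‖ = 1 := by simpa using hy2
      show ρ y ∈ sphere (0 : EuclideanSpace ℝ ι) 1
      simp [ρ.norm_map, this]
    · rw [map_smul]
  constructor
  · exact gen _ _ key _ _ rfl
  · refine gen _ _ (fun y => ?_) _ _ (key2 z)
    rw [← key, key2]
noncomputable def faceMap {ι : Type} [Fintype ι] [DecidableEq ι] (i : ι) (s : ℝ)
    (y : {j // j ≠ i} → ℝ) : EuclideanSpace ℝ ι :=
  WithLp.toLp 2 (fun j => if h : j = i then s else y ⟨j, h⟩)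

lemma faceMap_ne {ι : Type} [Fintype ι] [DecidableEq ι] (i : ι) (s : ℝ) (hs : s ≠ 0)
    (y : {j // j ≠ i} → ℝ) : faceMap i s y ≠ 0 := by
  intro h
  have := congrArg (fun z : EuclideanSpace ℝ ι => z i) h
  simp [faceMap] at this
  exact hs this

lemma faceMap_contDiff {ι : Type} [Fintype ι] [DecidableEq ι] (i : ι) (s : ℝ) :
    ContDiff ℝ 1 (faceMap i s) := by
  rw [contDiff_euclidean]
  intro j
  by_cases h : j = i
  · simp only [faceMap, h, dite_true]
    exact contDiff_const
  · simp only [faceMap, h, dite_false]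
    exact contDiff_apply ℝ ℝ _

lemma card_ne {ι : Type} [Fintype ι] [DecidableEq ι] (i : ι) :
    ((Fintype.card {j // j ≠ i} : ℕ) : ℝ) = (Fintype.card ι : ℝ) - 1 := by
  rw [Fintype.card_subtype_compl, Fintype.card_subtype_eq, Nat.cast_sub]
  · simp
  · exact Fintype.card_pos_iff.2 ⟨i⟩

lemma hausdorff_unit_sphere_lt_top {ι : Type} [Fintype ι] [Nonempty ι] :
    μH[(Fintype.card ι : ℝ) - 1] (sphere (0 : EuclideanSpace ℝ ι) 1) < ⊤ := by
  classical
  have hsub : sphere (0 : EuclideanSpace ℝ ι) 1 ⊆ ⋃ i : ι, ⋃ b : Bool,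
      (fun y => ‖faceMap i (if b then 1 else -1) y‖⁻¹ • faceMap i (if b then 1 else -1) y) ''
        closedBall 0 1 := by
    intro x hx
    have hx1 : ‖x‖ = 1 := by simpa using hx
    obtain ⟨i, hi⟩ := Finite.exists_max (fun i => |x i|)
    have hi0 : 0 < |x i| := by
      by_contra h
      have h0 : ∀ j, x j = 0 := fun j => by
        have := hi j
        have : |x j| ≤ 0 := by linarith
        exact abs_nonpos_iff.1 this
      have : x = 0 := by ext j; simpa using h0 j
      rw [this] at hx1; simp at hx1
    simp only [mem_iUnion]
    refine ⟨i, decide (0 < x i), fun j => x j / |x i|, ?_, ?_⟩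
    · rw [mem_closedBall_zero_iff, pi_norm_le_iff_of_nonneg zero_le_one]
      intro j
      rw [Real.norm_eq_abs, abs_div, abs_abs, div_le_one hi0]
      exact hi j
    · have : faceMap i (if decide (0 < x i) then 1 else -1) (fun j => x j / |x i|)
          = |x i|⁻¹ • x := by
        ext j
        by_cases h : j = i
        · subst h
          simp only [faceMap, dite_true, PiLp.smul_apply, smul_eq_mul]
          rcases lt_or_ge 0 (x j) with h | h
          · simp only [h, decide_true, if_true, abs_of_pos h]
            field_simp
          · have h' : x j ≠ 0 := abs_pos.1 hi0
            have : ¬ 0 < x j := not_lt.2 h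
            simp only [this, decide_false, abs_of_nonpos h]
            simp
            field_simp
        · simp [faceMap, h, div_eq_inv_mul]
      show ‖faceMap i (if decide (0 < x i) then 1 else -1) (fun j => x j / |x i|)‖⁻¹ •
        faceMap i (if decide (0 < x i) then 1 else -1) (fun j => x j / |x i|) = x
      rw [this, norm_smul, hx1, smul_smul]
      simp
      rw [mul_inv_cancel₀ hi0.ne', one_smul]
  refine (measure_mono hsub).trans_lt ?_
  refine (measure_iUnion_le _).trans_lt ?_
  rw [tsum_fintype]
  refine ENNReal.sum_lt_top.2 fun i _ => ?_
  refine (measure_iUnion_le _).trans_lt ?_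
  rw [tsum_fintype]
  refine ENNReal.sum_lt_top.2 fun b _ => ?_
  have hs : (if b then (1 : ℝ) else -1) ≠ 0 := by split_ifs <;> norm_num
  have hcd : ContDiff ℝ 1 (fun y => ‖faceMap i (if b then (1 : ℝ) else -1) y‖⁻¹ •
      faceMap i (if b then (1 : ℝ) else -1) y) := by
    have h1 := faceMap_contDiff i (if b then (1 : ℝ) else -1)
    have h2 := faceMap_ne i _ hs
    exact ((h1.norm ℝ h2).inv (fun y => norm_ne_zero_iff.2 (h2 y))).smul h1
  obtain ⟨K, hK⟩ := (hcd.locallyLipschitz.locallyLipschitzOn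
    (s := closedBall 0 1)).exists_lipschitzOnWith_of_compact (isCompact_closedBall _ _)
  have hd : 0 ≤ (Fintype.card ι : ℝ) - 1 := by rw [← card_ne i]; positivity
  refine (hK.hausdorffMeasure_image_le hd).trans_lt ?_
  refine ENNReal.mul_lt_top (by simp [ENNReal.rpow_lt_top_of_nonneg hd]) ?_
  rw [← card_ne i, hausdorffMeasure_pi_real]
  exact measure_closedBall_lt_top

lemma hausdorff_unit_sphere_pos {ι : Type} [Fintype ι] [Nonempty ι] :
    0 < μH[(Fintype.card ι : ℝ) - 1] (sphere (0 : EuclideanSpace ℝ ι) 1) := by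
  classical
  let i : ι := Classical.arbitrary ι
  have hd : 0 ≤ (Fintype.card ι : ℝ) - 1 := by rw [← card_ne i]; positivity
  let P : EuclideanSpace ℝ ι → ({j // j ≠ i} → ℝ) := fun x j => x j
  have hP : LipschitzWith 1 P := by
    refine LipschitzWith.of_dist_le_mul fun x y => ?_
    rw [NNReal.coe_one, one_mul, dist_pi_le_iff dist_nonneg]
    intro j
    show dist (x j) (y j) ≤ _
    have := PiLp.norm_apply_le (x - y) (j : ι)
    rwa [dist_eq_norm, dist_eq_norm]
  have h := hP.hausdorffMeasure_image_le hd (sphere (0 : EuclideanSpace ℝ ι) 1)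
  rw [ENNReal.coe_one, ENNReal.one_rpow, one_mul] at h
  refine lt_of_lt_of_le ?_ h
  rw [← card_ne i, hausdorffMeasure_pi_real]
  let U : Set ({j // j ≠ i} → ℝ) := {y | ∑ j, y j ^ 2 < 1}
  have hU : IsOpen U := isOpen_lt (by fun_prop) continuous_const
  have hU0 : (0 : {j // j ≠ i} → ℝ) ∈ U := by simp [U]
  refine lt_of_lt_of_le (hU.measure_pos volume ⟨0, hU0⟩) (measure_mono ?_)
  intro y hy
  have hy' : ∑ j, y j ^ 2 < 1 := hy
  refine ⟨faceMap i (Real.sqrt (1 - ∑ j, y j ^ 2)) y, ?_, ?_⟩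
  · rw [mem_sphere_zero_iff_norm, EuclideanSpace.norm_eq, Real.sqrt_eq_one]
    rw [← Fintype.sum_subtype_add_sum_subtype (fun j => j ≠ i)]
    have h1 : ∀ j : {j // j ≠ i}, ‖faceMap i (Real.sqrt (1 - ∑ j, y j ^ 2)) y j‖ ^ 2 = y j ^ 2 := by
      rintro ⟨j, hj⟩
      simp [faceMap, hj]
    have h2 : ∀ j : {j // ¬ j ≠ i}, ‖faceMap i (Real.sqrt (1 - ∑ j, y j ^ 2)) y j‖ ^ 2
        = 1 - ∑ j, y j ^ 2 := by
      rintro ⟨j, hj⟩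
      simp only [ne_eq, not_not] at hj
      simp only [faceMap, hj, dite_true, Real.norm_eq_abs, sq_abs]
      rw [Real.sq_sqrt (by linarith)]
    simp_rw [h1, h2]
    simp
  · funext j
    simp [P, faceMap, j.2]

lemma sphere_eq_image {ι : Type} [Fintype ι] (x : EuclideanSpace ℝ ι) {δ : ℝ} (hδ : 0 < δ) :
    sphere x δ = (fun z => x + z) '' (δ • sphere (0 : EuclideanSpace ℝ ι) 1) := by
  rw [smul_sphere' hδ.ne']
  ext z
  simp [abs_of_pos hδ, sub_eq_neg_add]

lemma hausdorff_sphere {ι : Type} [Fintype ι] [Nonempty ι] (x : EuclideanSpace ℝ ι) {δ : ℝ}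
    (hδ : 0 < δ) :
    μH[(Fintype.card ι : ℝ) - 1] (sphere x δ) ≠ 0 ∧
      μH[(Fintype.card ι : ℝ) - 1] (sphere x δ) ≠ ⊤ := by
  have hd : 0 ≤ (Fintype.card ι : ℝ) - 1 := by
    have : (1 : ℝ) ≤ Fintype.card ι := by exact_mod_cast Fintype.card_pos
    linarith
  have h : μH[(Fintype.card ι : ℝ) - 1] (sphere x δ) =
      ‖δ‖₊ ^ ((Fintype.card ι : ℝ) - 1) •
        μH[(Fintype.card ι : ℝ) - 1] (sphere (0 : EuclideanSpace ℝ ι) 1) := by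
    rw [sphere_eq_image x hδ, ← Measure.hausdorffMeasure_smul₀ hd hδ.ne']
    exact (IsometryEquiv.addLeft x).hausdorffMeasure_image _ _
  have hp : (‖δ‖₊ ^ ((Fintype.card ι : ℝ) - 1)) ≠ 0 := by
    have : 0 < ‖δ‖₊ := by simpa using hδ.ne'
    exact (NNReal.rpow_pos this).ne'
  rw [h, ENNReal.smul_def, smul_eq_mul]
  exact ⟨mul_ne_zero (by exact_mod_cast hp) hausdorff_unit_sphere_pos.ne',
    ENNReal.mul_ne_top (by simp) hausdorff_unit_sphere_lt_top.ne⟩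

lemma sphere_mean_le {ι : Type} [Fintype ι] [Nonempty ι] (f : EuclideanSpace ℝ ι → ℝ≥0∞)
    (hf : SuperharmonicFn ι f) (x : EuclideanSpace ℝ ι) {δ : ℝ} (hδ : 0 < δ) :
    ∫⁻ w : sphere (0 : EuclideanSpace ℝ ι) 1, f (x + δ • (w : EuclideanSpace ℝ ι))
        ∂(volume : Measure (EuclideanSpace ℝ ι)).toSphere
      ≤ (volume : Measure (EuclideanSpace ℝ ι)).toSphere univ * f x := by
  obtain ⟨hlsc, -, hmean⟩ := hf
  obtain ⟨hH0, hHt⟩ := hausdorff_sphere x hδ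
  have hfm := hlsc.measurable
  set T := (volume : Measure (EuclideanSpace ℝ ι)).toSphere with hT
  set H : Measure (EuclideanSpace ℝ ι) := μH[(Fintype.card ι : ℝ) - 1] with hH
  let φ : sphere (0 : EuclideanSpace ℝ ι) 1 → EuclideanSpace ℝ ι := fun w => x + δ • (w : EuclideanSpace ℝ ι)
  have hφ : Measurable φ := by fun_prop
  have hφS : ∀ w, φ w ∈ sphere x δ := by
    intro w
    simp [φ, norm_smul, abs_of_pos hδ]
  have hφball : ∀ w ε, φ ⁻¹' (ball (φ w) ε) = ball w (ε / δ) := by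
    intro w ε
    ext u
    simp only [φ, mem_preimage, mem_ball, dist_add_left, dist_smul₀, Subtype.dist_eq,
      Real.norm_eq_abs, abs_of_pos hδ]
    rw [lt_div_iff₀ hδ, mul_comm]
  have hφsurj : ∀ y ∈ sphere x δ, ∃ w, φ w = y := by
    intro y hy
    rw [sphere_eq_image x hδ] at hy
    obtain ⟨z, ⟨w, hw, rfl⟩, rfl⟩ := hy
    exact ⟨⟨w, hw⟩, rfl⟩
  have : Nontrivial (EuclideanSpace ℝ ι) := by infer_instance
  obtain ⟨w0⟩ : Nonempty (sphere (0 : EuclideanSpace ℝ ι) 1) :=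
    (NormedSpace.sphere_nonempty.2 zero_le_one).to_subtype
  have hT0 : T univ ≠ 0 := by
    rw [Ne, Measure.measure_univ_eq_zero]
    exact Measure.toSphere_ne_zero _
  have : IsFiniteMeasure (H.restrict (sphere x δ)) :=
    ⟨by rw [Measure.restrict_apply_univ]; exact hHt.lt_top⟩
  have hms : MeasurableSet (sphere x δ) := isClosed_sphere.measurableSet
  have key := fatou_compare (T.map φ) (H.restrict (sphere x δ)) (sphere x δ)
    ((ae_map_iff hφ.aemeasurable hms).2 (ae_of_all _ hφS))
    (ae_restrict_mem hms)
    (fun ε => T (ball w0 (ε / δ))) (fun ε => H (ball (φ w0) ε ∩ sphere x δ))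
    (by
      intro ε hε y hy
      obtain ⟨w, rfl⟩ := hφsurj y hy
      rw [Measure.map_apply hφ measurableSet_ball, hφball]
      exact toSphere_ball_eq _ _ _)
    (by
      intro ε hε y hy
      rw [Measure.restrict_apply measurableSet_ball]
      obtain ⟨w, rfl⟩ := hφsurj y hy
      have hw : ‖(w : EuclideanSpace ℝ ι)‖ = ‖(w0 : EuclideanSpace ℝ ι)‖ := by simp
      set ρ := Submodule.reflection (ℝ ∙ ((w : EuclideanSpace ℝ ι) - w0))ᗮ with hρ
      have h1 : ρ (w : EuclideanSpace ℝ ι) = w0 := Submodule.reflection_sub hw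
      let R : EuclideanSpace ℝ ι ≃ᵢ EuclideanSpace ℝ ι :=
        ((IsometryEquiv.addLeft (-x)).trans ρ.toIsometryEquiv).trans (IsometryEquiv.addLeft x)
      have hR : ∀ z, R z = x + ρ (-x + z) := fun z => rfl
      have hRx : R x = x := by simp [hR]
      have hRw : R (φ w) = φ w0 := by simp [hR, φ, h1]
      rw [← R.hausdorffMeasure_image, image_inter R.injective, R.image_ball, R.image_sphere, hRx, hRw])
    (by
      intro ε hε
      exact (isOpen_ball.measure_pos _ ⟨w0, mem_ball_self (div_pos hε hδ)⟩).ne')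
    (by rwa [Measure.map_apply hφ MeasurableSet.univ])
    (by rwa [Measure.restrict_apply_univ])
    f hlsc
  rw [lintegral_map hfm hφ, Measure.map_apply hφ MeasurableSet.univ, preimage_univ,
    Measure.restrict_apply_univ] at key
  refine key.trans ?_
  gcongr
  have := hmean x δ hδ
  rwa [Measure.restrict_smul, lintegral_smul_measure, smul_eq_mul] at this

lemma lintegral_polar {ι : Type} [Fintype ι] [Nonempty ι] (F : EuclideanSpace ℝ ι → ℝ≥0∞)
    (hF : Measurable F) :
    ∫⁻ z, F z = ∫⁻ r : Ioi (0 : ℝ), ∫⁻ w : sphere (0 : EuclideanSpace ℝ ι) 1,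
      F ((r : ℝ) • (w : EuclideanSpace ℝ ι)) ∂(volume : Measure (EuclideanSpace ℝ ι)).toSphere
        ∂(Measure.volumeIoiPow (Module.finrank ℝ (EuclideanSpace ℝ ι) - 1)) := by
  have h0 : MeasurableSet ({(0 : EuclideanSpace ℝ ι)}ᶜ) := (measurableSet_singleton _).compl
  have hm := (volume : Measure (EuclideanSpace ℝ ι)).measurePreserving_homeomorphUnitSphereProd
  calc ∫⁻ z, F z = ∫⁻ z in ({(0 : EuclideanSpace ℝ ι)}ᶜ), F z := by
        rw [restrict_compl_singleton]
    _ = ∫⁻ z : ({(0 : EuclideanSpace ℝ ι)}ᶜ : Set (EuclideanSpace ℝ ι)), F z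
          ∂((volume : Measure (EuclideanSpace ℝ ι)).comap (↑)) := by
        rw [lintegral_subtype_comap h0]
    _ = ∫⁻ p, F ((p.2 : ℝ) • (p.1 : EuclideanSpace ℝ ι)) ∂
          ((volume : Measure (EuclideanSpace ℝ ι)).toSphere.prod
            (Measure.volumeIoiPow (Module.finrank ℝ (EuclideanSpace ℝ ι) - 1))) := by
        rw [← hm.lintegral_comp_emb (Homeomorph.measurableEmbedding _)]
        refine lintegral_congr fun z => ?_
        congr 1
        have := congrArg Subtype.val
          ((homeomorphUnitSphereProd (EuclideanSpace ℝ ι)).symm_apply_apply z)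
        rw [homeomorphUnitSphereProd_symm_apply_coe] at this
        exact this.symm
    _ = _ := by
        rw [lintegral_prod_symm' _ (by fun_prop)]

lemma radial_mean_le {ι : Type} [Fintype ι] [Nonempty ι] (f : EuclideanSpace ℝ ι → ℝ≥0∞)
    (hf : SuperharmonicFn ι f) (x : EuclideanSpace ℝ ι) {c : ℝ} (hc : 0 < c)
    (g : ℝ → ℝ≥0∞) (hg : Measurable g) :
    ∫⁻ z, g ‖z‖ * f (x + c • z) ≤ (∫⁻ z : EuclideanSpace ℝ ι, g ‖z‖) * f x := by
  have hfm := hf.1.measurable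
  rw [lintegral_polar _ (by fun_prop), lintegral_polar (fun z => g ‖z‖) (by fun_prop)]
  have hn : ∀ (r : Ioi (0 : ℝ)) (w : sphere (0 : EuclideanSpace ℝ ι) 1),
      ‖(r : ℝ) • (w : EuclideanSpace ℝ ι)‖ = r := by
    intro r w
    have : (0 : ℝ) < r := r.2
    simp [norm_smul, abs_of_pos this]
  simp_rw [hn, lintegral_const]
  rw [← lintegral_mul_const _ (by fun_prop)]
  refine lintegral_mono fun r => ?_
  have hr : (0 : ℝ) < r := r.2
  rw [lintegral_const_mul _ (by fun_prop), mul_assoc]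
  gcongr
  simp_rw [smul_smul]
  exact sphere_mean_le f hf x (mul_pos hc hr)

lemma pdens_pos (n m : ℕ) {v : ℝ} (hv : 0 < v) (X M : EuclideanSpace ℝ (Fin n × Fin m)) :
    0 < pdens n m v X M := by
  unfold pdens; positivity

lemma pdens_comm (n m : ℕ) (v : ℝ) (X M : EuclideanSpace ℝ (Fin n × Fin m)) :
    pdens n m v X M = pdens n m v M X := by
  unfold pdens; rw [norm_sub_rev]

lemma pdens_zero (n m : ℕ) (v : ℝ) (X M : EuclideanSpace ℝ (Fin n × Fin m)) :
    pdens n m v X M = pdens n m v 0 (M - X) := by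
  unfold pdens; rw [zero_sub, norm_neg, norm_sub_rev]

lemma continuous_pdens (n m : ℕ) (v : ℝ) :
    Continuous (fun p : EuclideanSpace ℝ (Fin n × Fin m) × EuclideanSpace ℝ (Fin n × Fin m) =>
      pdens n m v p.1 p.2) := by
  unfold pdens
  fun_prop

@[fun_prop]
lemma measurable_pdens {α : Type*} [MeasurableSpace α] (n m : ℕ) (v : ℝ)
    {f g : α → EuclideanSpace ℝ (Fin n × Fin m)} (hf : Measurable f) (hg : Measurable g) :
    Measurable (fun a => pdens n m v (f a) (g a)) := by
  unfold pdens
  fun_prop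

lemma pdens_lintegral (n m : ℕ) {v : ℝ} (hv : 0 < v) (X : EuclideanSpace ℝ (Fin n × Fin m)) :
    ∫⁻ M, ENNReal.ofReal (pdens n m v X M) = 1 := by
  simp_rw [pdens_zero n m v X]
  rw [lintegral_sub_right_eq_self (fun M => ENNReal.ofReal (pdens n m v 0 M)) X]
  have hb : 0 < 1 / (2 * v) := by positivity
  have h := GaussianFourier.integral_rexp_neg_mul_sq_norm
    (V := EuclideanSpace ℝ (Fin n × Fin m)) hb
  have hpos : 0 < (Real.pi / (1 / (2 * v))) ^
      ((Module.finrank ℝ (EuclideanSpace ℝ (Fin n × Fin m)) : ℝ) / 2) := by positivity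
  have hint : Integrable fun z : EuclideanSpace ℝ (Fin n × Fin m) =>
      Real.exp (-(1 / (2 * v)) * ‖z‖ ^ 2) := by
    by_contra hc
    rw [integral_undef hc] at h
    exact hpos.ne h
  have he : ∀ z : EuclideanSpace ℝ (Fin n × Fin m), pdens n m v 0 z =
      (2 * Real.pi * v) ^ (-((n : ℝ) * m) / 2) * Real.exp (-(1 / (2 * v)) * ‖z‖ ^ 2) := by
    intro z
    unfold pdens
    rw [zero_sub, norm_neg]
    congr 2
    ring
  rw [← ofReal_integral_eq_lintegral_ofReal, ← ENNReal.ofReal_one]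
  · congr 1
    simp_rw [he]
    rw [integral_const_mul, h]
    have e1 : Real.pi / (1 / (2 * v)) = 2 * Real.pi * v := by field_simp
    have e2 : ((Module.finrank ℝ (EuclideanSpace ℝ (Fin n × Fin m)) : ℕ) : ℝ) = (n : ℝ) * m := by
      simp
    rw [e1, e2, ← Real.rpow_add (by positivity)]
    rw [neg_div, neg_add_cancel, Real.rpow_zero]
  · exact (hint.const_mul _).congr (ae_of_all _ fun z => (he z).symm)
  · exact ae_of_all _ fun z => (pdens_pos n m hv _ _).le

lemma pdens_mul (n m : ℕ) {a b : ℝ} (ha : 0 < a) (hb : 0 < b)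
    (X Y M : EuclideanSpace ℝ (Fin n × Fin m)) :
    pdens n m a X M * pdens n m b Y M =
      pdens n m (a + b) X Y * pdens n m (a * b / (a + b)) (Y + (b / (a + b)) • (X - Y)) M := by
  unfold pdens
  have hc : (2 * Real.pi * a) ^ (-((n : ℝ) * m) / 2) * (2 * Real.pi * b) ^ (-((n : ℝ) * m) / 2)
      = (2 * Real.pi * (a + b)) ^ (-((n : ℝ) * m) / 2) *
        (2 * Real.pi * (a * b / (a + b))) ^ (-((n : ℝ) * m) / 2) := by
    rw [← Real.mul_rpow (by positivity) (by positivity),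
      ← Real.mul_rpow (by positivity) (by positivity)]
    congr 1
    field_simp
  have he : -‖X - M‖ ^ 2 / (2 * a) + -‖Y - M‖ ^ 2 / (2 * b) =
      -‖X - Y‖ ^ 2 / (2 * (a + b)) +
        -‖Y + (b / (a + b)) • (X - Y) - M‖ ^ 2 / (2 * (a * b / (a + b))) := by
    obtain ⟨p, hp⟩ : ∃ p, p = X - M := ⟨_, rfl⟩
    obtain ⟨q, hq⟩ : ∃ q, q = Y - M := ⟨_, rfl⟩
    have h1 : X - Y = p - q := by rw [hp, hq]; abel
    have h2 : Y + (b / (a + b)) • (X - Y) - M = q + (b / (a + b)) • (p - q) := by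
      rw [h1, hq]; abel
    rw [h2, h1, ← hp, ← hq, norm_add_sq_real, norm_smul, mul_pow, real_inner_smul_right,
      inner_sub_right, norm_sub_sq_real p q, real_inner_self_eq_norm_sq, real_inner_comm p q,
      Real.norm_eq_abs, sq_abs]
    have : a + b ≠ 0 := by positivity
    field_simp
    ring
  calc _ = ((2 * Real.pi * a) ^ (-((n : ℝ) * m) / 2) * (2 * Real.pi * b) ^ (-((n : ℝ) * m) / 2)) *
        Real.exp (-‖X - M‖ ^ 2 / (2 * a) + -‖Y - M‖ ^ 2 / (2 * b)) := by
        rw [Real.exp_add]; ring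
    _ = _ := by rw [hc, he, Real.exp_add]; ring

lemma gauss_mean_le (n m : ℕ) [Nonempty (Fin n × Fin m)] {v : ℝ} (hv : 0 < v)
    (π : EuclideanSpace ℝ (Fin n × Fin m) → ℝ≥0∞)
    (hsup : SuperharmonicFn (Fin n × Fin m) π) (x : EuclideanSpace ℝ (Fin n × Fin m))
    {c : ℝ} (hc : 0 < c) :
    ∫⁻ U, ENNReal.ofReal (pdens n m v 0 U) * π (x + c • U) ≤ π x := by
  have h := radial_mean_le π hsup x hc (fun r => ENNReal.ofReal
    ((2 * Real.pi * v) ^ (-((n : ℝ) * m) / 2) * Real.exp (-r ^ 2 / (2 * v)))) (by fun_prop)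
  have he : ∀ z : EuclideanSpace ℝ (Fin n × Fin m), ENNReal.ofReal
    ((2 * Real.pi * v) ^ (-((n : ℝ) * m) / 2) * Real.exp (-‖z‖ ^ 2 / (2 * v)))
      = ENNReal.ofReal (pdens n m v 0 z) := by
    intro z; unfold pdens; rw [zero_sub, norm_neg]
  simp_rw [he] at h
  rwa [pdens_lintegral n m hv, one_mul] at h

lemma measurable_marg (n m : ℕ) (π : EuclideanSpace ℝ (Fin n × Fin m) → ℝ≥0∞)
    (hπ : Measurable π) (v : ℝ) : Measurable (marg n m π v) := by
  unfold marg
  apply Measurable.lintegral_prod_right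
  exact (measurable_pdens n m v measurable_fst measurable_snd).ennreal_ofReal.mul (hπ.comp measurable_snd)

/-- the marginal is nonincreasing in the variance -/
lemma marg_mono (n m : ℕ) [Nonempty (Fin n × Fin m)] {u v : ℝ} (hu : 0 < u) (huv : u < v)
    (π : EuclideanSpace ℝ (Fin n × Fin m) → ℝ≥0∞)
    (hsup : SuperharmonicFn (Fin n × Fin m) π) (W : EuclideanSpace ℝ (Fin n × Fin m)) :
    marg n m π v W ≤ marg n m π u W := by
  have hπ := hsup.1.measurable
  have hτ : 0 < v - u := sub_pos.2 huv
  have hsemi : ∀ μ, ENNReal.ofReal (pdens n m v W μ) =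
      ∫⁻ x, ENNReal.ofReal (pdens n m u W x) * ENNReal.ofReal (pdens n m (v - u) μ x) := by
    intro μ
    simp_rw [← ENNReal.ofReal_mul (pdens_pos n m hu _ _).le, pdens_mul n m hu hτ,
      ENNReal.ofReal_mul (pdens_pos n m (add_pos hu hτ) _ _).le]
    rw [lintegral_const_mul _ (by fun_prop),
      pdens_lintegral n m (by positivity), mul_one, add_sub_cancel]
  unfold marg
  simp_rw [hsemi]
  calc ∫⁻ μ, (∫⁻ x, ENNReal.ofReal (pdens n m u W x) * ENNReal.ofReal (pdens n m (v - u) μ x)) * π μ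
      = ∫⁻ μ, ∫⁻ x, ENNReal.ofReal (pdens n m u W x) *
          (ENNReal.ofReal (pdens n m (v - u) x μ) * π μ) := by
        refine lintegral_congr fun μ => ?_
        rw [← lintegral_mul_const _ (by fun_prop)]
        simp_rw [mul_assoc, pdens_comm n m (v - u) μ]
    _ = ∫⁻ x, ∫⁻ μ, ENNReal.ofReal (pdens n m u W x) *
          (ENNReal.ofReal (pdens n m (v - u) x μ) * π μ) := by
        rw [lintegral_lintegral_swap]
        exact Measurable.aemeasurable (by fun_prop)
    _ ≤ _ := by
        refine lintegral_mono fun x => ?_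
        dsimp only
        rw [lintegral_const_mul _ (by fun_prop)]
        gcongr
        have h := gauss_mean_le n m hτ π hsup x one_pos
        rw [← lintegral_sub_right_eq_self _ x] at h
        simp only [one_smul, add_sub_cancel] at h
        simpa only [← pdens_zero] using h

lemma marg_mean_le (n m : ℕ) [Nonempty (Fin n × Fin m)] {s v : ℝ} (hs : 0 < s)
    (π : EuclideanSpace ℝ (Fin n × Fin m) → ℝ≥0∞)
    (hsup : SuperharmonicFn (Fin n × Fin m) π) (W : EuclideanSpace ℝ (Fin n × Fin m))
    {c : ℝ} (hc : 0 < c) :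
    ∫⁻ U, ENNReal.ofReal (pdens n m s 0 U) * marg n m π v (W + c • U) ≤ marg n m π v W := by
  have hπ := hsup.1.measurable
  have h1 : ∀ U, marg n m π v (W + c • U) =
      ∫⁻ μ, ENNReal.ofReal (pdens n m v W μ) * π (μ + c • U) := by
    intro U
    unfold marg
    rw [← lintegral_add_right_eq_self _ (c • U)]
    refine lintegral_congr fun μ => ?_
    congr 2
    rw [pdens_zero, pdens_zero n m v W]
    congr 1
    abel
  simp_rw [h1]
  calc ∫⁻ U, ENNReal.ofReal (pdens n m s 0 U) *
        ∫⁻ μ, ENNReal.ofReal (pdens n m v W μ) * π (μ + c • U)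
      = ∫⁻ U, ∫⁻ μ, ENNReal.ofReal (pdens n m v W μ) *
          (ENNReal.ofReal (pdens n m s 0 U) * π (μ + c • U)) := by
        refine lintegral_congr fun U => ?_
        rw [← lintegral_const_mul _ (by fun_prop)]
        refine lintegral_congr fun μ => ?_
        ring
    _ = ∫⁻ μ, ∫⁻ U, ENNReal.ofReal (pdens n m v W μ) *
          (ENNReal.ofReal (pdens n m s 0 U) * π (μ + c • U)) := by
        rw [lintegral_lintegral_swap]
        exact Measurable.aemeasurable (by fun_prop)
    _ ≤ _ := by
        unfold marg
        refine lintegral_mono fun x => ?_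
        dsimp only
        rw [lintegral_const_mul _ (by fun_prop)]
        gcongr
        exact gauss_mean_le n m hs π hsup x hc

lemma main_bound (n m : ℕ) [Nonempty (Fin n × Fin m)]
    (v₁ v₂ : ℝ) (hv₁ : 0 < v₁) (hv₂ : 0 < v₂)
    (π : EuclideanSpace ℝ (Fin n × Fin m) → ℝ≥0∞)
    (hsup : SuperharmonicFn (Fin n × Fin m) π)
    (hmarg : ∀ (Z : EuclideanSpace ℝ (Fin n × Fin m)) (v : ℝ), 0 < v →
      0 < marg n m π v Z ∧ marg n m π v Z ≠ ⊤)
    (M : EuclideanSpace ℝ (Fin n × Fin m)) :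
    ∫⁻ p : EuclideanSpace ℝ (Fin n × Fin m) × EuclideanSpace ℝ (Fin n × Fin m),
      ENNReal.ofReal (pdens n m v₁ p.1 M * pdens n m v₂ p.2 M) *
        (marg n m π v₁ p.1 * (marg n m π (v₂ * v₁ / (v₂ + v₁))
          (p.1 + (v₁ / (v₂ + v₁)) • (p.2 - p.1)))⁻¹) ≤ 1 := by
  have hπ := hsup.1.measurable
  set s := v₂ + v₁ with hs
  have hspos : 0 < s := by positivity
  set c := v₁ / s with hcdef
  have hc : 0 < c := by positivity
  set u := v₂ * v₁ / s with hu
  have hupos : 0 < u := by positivity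
  have huv : u < v₁ := by
    rw [hu, div_lt_iff₀ hspos, hs]; nlinarith
  have hm1 := measurable_marg n m π hπ v₁
  have hmu := measurable_marg n m π hπ u
  let h : EuclideanSpace ℝ (Fin n × Fin m) → ℝ≥0∞ := fun w =>
    ENNReal.ofReal (pdens n m u w M) * (marg n m π u w)⁻¹
  have hh : Measurable h := (measurable_pdens n m _ measurable_id measurable_const).ennreal_ofReal.mul hmu.inv
  let g : EuclideanSpace ℝ (Fin n × Fin m) → ℝ≥0∞ := fun U => ENNReal.ofReal (pdens n m s 0 U)
  have hg : Measurable g :=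
    (measurable_pdens n m _ measurable_const measurable_id).ennreal_ofReal
  have h1 : ∀ p : EuclideanSpace ℝ (Fin n × Fin m) × EuclideanSpace ℝ (Fin n × Fin m),
      ENNReal.ofReal (pdens n m v₁ p.1 M * pdens n m v₂ p.2 M) *
        (marg n m π v₁ p.1 * (marg n m π u (p.1 + c • (p.2 - p.1)))⁻¹)
      = g (p.1 - p.2) * (h (p.1 - c • (p.1 - p.2)) * marg n m π v₁ p.1) := by
    intro p
    have e : p.1 - c • (p.1 - p.2) = p.1 + c • (p.2 - p.1) := by
      rw [← neg_sub p.1 p.2, smul_neg, sub_eq_add_neg]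
    rw [mul_comm (pdens n m v₁ p.1 M), pdens_mul n m hv₂ hv₁,
      ENNReal.ofReal_mul (pdens_pos n m hspos _ _).le, e]
    simp only [g, h]
    rw [pdens_zero n m _ p.2 p.1]
    ring
  simp_rw [h1]
  rw [Measure.volume_eq_prod, lintegral_prod _ (Measurable.aemeasurable (by fun_prop))]
  calc ∫⁻ Y, ∫⁻ Yt, g (Y - Yt) * (h (Y - c • (Y - Yt)) * marg n m π v₁ Y)
      = ∫⁻ Y, ∫⁻ U, g U * (h (Y - c • U) * marg n m π v₁ Y) := by
        refine lintegral_congr fun Y => ?_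
        exact lintegral_sub_left_eq_self (fun U => g U * (h (Y - c • U) * marg n m π v₁ Y)) Y
    _ = ∫⁻ U, ∫⁻ Y, g U * (h (Y - c • U) * marg n m π v₁ Y) := by
        rw [lintegral_lintegral_swap]
        exact Measurable.aemeasurable (by fun_prop)
    _ = ∫⁻ U, ∫⁻ w, g U * (h w * marg n m π v₁ (w + c • U)) := by
        refine lintegral_congr fun U => ?_
        rw [← lintegral_add_right_eq_self _ (c • U)]
        simp only [add_sub_cancel_right]
    _ = ∫⁻ w, ∫⁻ U, g U * (h w * marg n m π v₁ (w + c • U)) := by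
        rw [lintegral_lintegral_swap]
        exact Measurable.aemeasurable (by fun_prop)
    _ = ∫⁻ w, h w * ∫⁻ U, g U * marg n m π v₁ (w + c • U) := by
        refine lintegral_congr fun w => ?_
        rw [← lintegral_const_mul _ (by fun_prop)]
        refine lintegral_congr fun U => ?_
        ring
    _ ≤ ∫⁻ w, h w * marg n m π u w := by
        refine lintegral_mono fun w => ?_
        dsimp only
        gcongr
        exact (marg_mean_le n m hspos π hsup w hc).trans (marg_mono n m hupos huv π hsup w)
    _ = ∫⁻ w, ENNReal.ofReal (pdens n m u M w) := by
        refine lintegral_congr fun w => ?_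
        obtain ⟨ha, hb⟩ := hmarg w u hupos
        simp only [h]
        rw [mul_assoc, ENNReal.inv_mul_cancel ha.ne' hb, mul_one, pdens_comm]
    _ = 1 := pdens_lintegral n m hupos M

theorem stmt12 (n m : ℕ) (hn : 1 ≤ n) (hm : 1 ≤ m)
    (v₁ v₂ : ℝ) (hv₁ : 0 < v₁) (hv₂ : 0 < v₂)
    (π : EuclideanSpace ℝ (Fin n × Fin m) → ℝ≥0∞)
    (hsup : SuperharmonicFn (Fin n × Fin m) π)
    (hmarg : ∀ (Z : EuclideanSpace ℝ (Fin n × Fin m)) (v : ℝ), 0 < v →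
      0 < marg n m π v Z ∧ marg n m π v Z ≠ ⊤)
    (M : EuclideanSpace ℝ (Fin n × Fin m))
    (hintI : Integrable (fun p : EuclideanSpace ℝ (Fin n × Fin m) × EuclideanSpace ℝ (Fin n × Fin m) =>
      pdens n m v₁ p.1 M * pdens n m v₂ p.2 M *
        Real.log (pdens n m v₂ p.2 M / predI n m v₁ v₂ p.1 p.2)))
    (hintπ : Integrable (fun p : EuclideanSpace ℝ (Fin n × Fin m) × EuclideanSpace ℝ (Fin n × Fin m) =>
      pdens n m v₁ p.1 M * pdens n m v₂ p.2 M *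
        Real.log (pdens n m v₂ p.2 M / predPi n m π v₁ v₂ p.1 p.2))) :
    RKL n m v₁ v₂ M (predPi n m π v₁ v₂) ≤ RKL n m v₁ v₂ M (predI n m v₁ v₂) := by
  have hne : Nonempty (Fin n × Fin m) := ⟨(⟨0, hn⟩, ⟨0, hm⟩)⟩
  have hπ := hsup.1.measurable
  have hspos : 0 < v₂ + v₁ := by positivity
  have hupos : 0 < v₂ * v₁ / (v₂ + v₁) := by positivity
  let W : EuclideanSpace ℝ (Fin n × Fin m) × EuclideanSpace ℝ (Fin n × Fin m) →
    EuclideanSpace ℝ (Fin n × Fin m) := fun p => p.1 + (v₁ / (v₂ + v₁)) • (p.2 - p.1)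
  let q : EuclideanSpace ℝ (Fin n × Fin m) × EuclideanSpace ℝ (Fin n × Fin m) → ℝ := fun p =>
    pdens n m v₁ p.1 M * pdens n m v₂ p.2 M
  let A : EuclideanSpace ℝ (Fin n × Fin m) × EuclideanSpace ℝ (Fin n × Fin m) → ℝ := fun p =>
    (marg n m π v₁ p.1).toReal
  let B : EuclideanSpace ℝ (Fin n × Fin m) × EuclideanSpace ℝ (Fin n × Fin m) → ℝ := fun p =>
    (marg n m π (v₂ * v₁ / (v₂ + v₁)) (W p)).toReal
  have hA : ∀ p, 0 < A p := fun p =>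
    ENNReal.toReal_pos (hmarg p.1 v₁ hv₁).1.ne' (hmarg p.1 v₁ hv₁).2
  have hB : ∀ p, 0 < B p := fun p =>
    ENNReal.toReal_pos (hmarg (W p) _ hupos).1.ne' (hmarg (W p) _ hupos).2
  have hq : ∀ p, 0 < q p := fun p => mul_pos (pdens_pos n m hv₁ _ _) (pdens_pos n m hv₂ _ _)
  have hqm : Measurable q :=
    (((continuous_pdens n m v₁).comp (continuous_fst.prodMk continuous_const)).mul
      ((continuous_pdens n m v₂).comp (continuous_snd.prodMk continuous_const))).measurable
  have hWm : Measurable W := by fun_prop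
  have hAm : Measurable A := ((measurable_marg n m π hπ v₁).comp measurable_fst).ennreal_toReal
  have hBm : Measurable B := ((measurable_marg n m π hπ _).comp hWm).ennreal_toReal
  have hpred : ∀ p, predPi n m π v₁ v₂ p.1 p.2 = predI n m v₁ v₂ p.1 p.2 * (B p / A p) := by
    intro p
    unfold predPi predI
    have h1 : ∫⁻ μ, ENNReal.ofReal (pdens n m v₂ p.2 μ * pdens n m v₁ p.1 μ) * π μ =
        ENNReal.ofReal (pdens n m (v₁ + v₂) p.2 p.1) *
          marg n m π (v₂ * v₁ / (v₂ + v₁)) (W p) := by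
      unfold marg
      rw [← lintegral_const_mul _
        (by fun_prop)]
      refine lintegral_congr fun μ => ?_
      rw [pdens_mul n m hv₂ hv₁, ENNReal.ofReal_mul (pdens_pos n m hspos _ _).le, mul_assoc,
        add_comm v₁ v₂]
    rw [h1, ENNReal.toReal_mul, ENNReal.toReal_ofReal (pdens_pos n m (by positivity) _ _).le,
      mul_div_assoc]
  have hqint1 : ∫⁻ p, ENNReal.ofReal (q p) = 1 := by
    have : ∀ p, ENNReal.ofReal (q p) =
        ENNReal.ofReal (pdens n m v₁ p.1 M) * ENNReal.ofReal (pdens n m v₂ p.2 M) := fun p =>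
      ENNReal.ofReal_mul (pdens_pos n m hv₁ _ _).le
    simp_rw [this]
    rw [Measure.volume_eq_prod, lintegral_prod_mul
      (f := fun Y => ENNReal.ofReal (pdens n m v₁ Y M))
      (g := fun Y => ENNReal.ofReal (pdens n m v₂ Y M))
      (Measurable.aemeasurable (by fun_prop)) (Measurable.aemeasurable (by fun_prop))]
    simp_rw [pdens_comm n m _ _ M]
    rw [pdens_lintegral n m hv₁, pdens_lintegral n m hv₂, one_mul]
  have hqI : Integrable q := by
    refine ⟨hqm.aestronglyMeasurable, ?_⟩
    rw [hasFiniteIntegral_iff_ofReal (ae_of_all _ fun p => (hq p).le), hqint1]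
    exact one_lt_top
  have hq1 : ∫ p, q p = 1 := by
    rw [integral_eq_lintegral_of_nonneg_ae (ae_of_all _ fun p => (hq p).le)
      hqm.aestronglyMeasurable, hqint1, ENNReal.toReal_one]
  have hEm : Measurable fun p => q p * (A p / B p) := hqm.mul (hAm.div hBm)
  have hE0 : ∀ p, 0 ≤ q p * (A p / B p) := fun p =>
    mul_nonneg (hq p).le (div_nonneg (hA p).le (hB p).le)
  have hE : ∫⁻ p, ENNReal.ofReal (q p * (A p / B p)) ≤ 1 := by
    refine le_trans (le_of_eq ?_) (main_bound n m v₁ v₂ hv₁ hv₂ π hsup hmarg M)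
    refine lintegral_congr fun p => ?_
    rw [ENNReal.ofReal_mul (hq p).le, ENNReal.ofReal_div_of_pos (hB p),
      ENNReal.ofReal_toReal (hmarg _ _ hv₁).2, ENNReal.ofReal_toReal (hmarg _ _ hupos).2,
      div_eq_mul_inv]
  have hEI : Integrable fun p => q p * (A p / B p) := by
    refine ⟨hEm.aestronglyMeasurable, ?_⟩
    rw [hasFiniteIntegral_iff_ofReal (ae_of_all _ hE0)]
    exact hE.trans_lt one_lt_top
  have hE1 : ∫ p, q p * (A p / B p) ≤ 1 := by
    rw [integral_eq_lintegral_of_nonneg_ae (ae_of_all _ hE0) hEm.aestronglyMeasurable]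
    exact ENNReal.toReal_mono one_ne_top hE
  have hpt : ∀ p, q p * Real.log (pdens n m v₂ p.2 M / predPi n m π v₁ v₂ p.1 p.2) ≤
      q p * Real.log (pdens n m v₂ p.2 M / predI n m v₁ v₂ p.1 p.2)
        + (q p * (A p / B p) - q p) := by
    intro p
    have hI : 0 < predI n m v₁ v₂ p.1 p.2 := pdens_pos n m (by positivity) _ _
    have hp2 := pdens_pos n m hv₂ p.2 M
    have hAB : 0 < A p / B p := div_pos (hA p) (hB p)
    have e : pdens n m v₂ p.2 M / predPi n m π v₁ v₂ p.1 p.2 =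
        (pdens n m v₂ p.2 M / predI n m v₁ v₂ p.1 p.2) * (A p / B p) := by
      rw [hpred]
      have := (hA p).ne'
      have := (hB p).ne'
      field_simp
    rw [e, Real.log_mul (div_pos hp2 hI).ne' hAB.ne', mul_add]
    have := mul_le_mul_of_nonneg_left (Real.log_le_sub_one_of_pos hAB) (hq p).le
    linarith
  unfold RKL
  calc _ ≤ ∫ p, (q p * Real.log (pdens n m v₂ p.2 M / predI n m v₁ v₂ p.1 p.2)
        + (q p * (A p / B p) - q p)) :=
        integral_mono hintπ (hintI.add (hEI.sub hqI)) hpt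
    _ = (∫ p, q p * Real.log (pdens n m v₂ p.2 M / predI n m v₁ v₂ p.1 p.2))
        + ((∫ p, q p * (A p / B p)) - ∫ p, q p) := by
        rw [← integral_sub hEI hqI]
        exact integral_add hintI (hEI.sub hqI)
    _ ≤ _ := by
        rw [hq1]
        have : ∫ p, q p * Real.log (pdens n m v₂ p.2 M / predI n m v₁ v₂ p.1 p.2) =
          ∫ p : EuclideanSpace ℝ (Fin n × Fin m) × EuclideanSpace ℝ (Fin n × Fin m),
            pdens n m v₁ p.1 M * pdens n m v₂ p.2 M *
              Real.log (pdens n m v₂ p.2 M / predI n m v₁ v₂ p.1 p.2) := rfl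
        linarith
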